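/- arXiv:1902.10337 — 6 statements merged into one kernel-verified Lean document; each statement's English description precedes it below -/
import Mathlib

section
/- Let G be a simple graph on n ≥ 3 vertices, let H be a Hamiltonian cycle of G, and let L be a circle ordering of G with g(L) ≥ 1. Then there exists a circle ordering L′ obtained from L by applying at most one κ-move and at most one γ-move (in some order) such that dist(L′, H) ≤ dist(L, H) − 1 and g(L′) ≤ g(L) + 1; consequently Δ(L′, H) ≤ Δ(L, H) − 2/3. -/
variable {V : Type*}

/-- The adjacent pairs of a circle ordering `L`: the unordered pairs
`{vᵢ, vᵢ₊₁}` (indices mod `L.length`). -/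
def adjPairs (L : List V) : List (Sym2 V) :=
  (L.zip (L.rotate 1)).map (fun p => s(p.1, p.2))

/-- `L` is a circle ordering of the vertex set `V`: a list containing every
vertex exactly once, regarded cyclically. -/
def IsCircleOrdering [Fintype V] (L : List V) : Prop :=
  L.Nodup ∧ ∀ v : V, v ∈ L

/-- `g(L)`: the number of gaps of `L`, i.e. adjacent pairs of `L` that are
not edges of `G`. -/
noncomputable def numGaps (G : SimpleGraph V) (L : List V) : ℕ :=
  (adjPairs L).countP (fun e => @decide (e ∉ G.edgeSet) (Classical.propDecidable _))

/-- `dist(L, H) = n - (number of adjacent pairs of `L` lying in the edge set `H`)`. -/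
noncomputable def distTo (H : Set (Sym2 V)) (L : List V) : ℕ :=
  L.length - (adjPairs L).countP (fun e => @decide (e ∈ H) (Classical.propDecidable _))

/-- `Δ(L, H) = g(L)/3 + dist(L, H)`. -/
noncomputable def delta (G : SimpleGraph V) (H : Set (Sym2 V)) (L : List V) : ℚ :=
  (numGaps G L : ℚ) / 3 + (distTo H L : ℚ)

/-- Two circle orderings are equivalent iff one is obtained from the other by a
cyclic rotation, a reversal of the order, or a composition of both. -/
def OrderEquiv (L M : List V) : Prop :=
  (∃ k, M = L.rotate k) ∨ (∃ k, M = L.reverse.rotate k)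

/-- A γ-move maps an ordering `A ++ B` (with `A`, `B` nonempty) to
`A.reverse ++ B`. -/
def GammaMove (L M : List V) : Prop :=
  ∃ A B : List V, A ≠ [] ∧ B ≠ [] ∧ L = A ++ B ∧ M = A.reverse ++ B

/-- A κ-move maps an ordering `A ++ B ++ C ++ D` (with `A`, `B`, `D` nonempty,
`C` possibly empty) to `A.reverse ++ B.reverse ++ D ++ C.reverse`. -/
def KappaMove (L M : List V) : Prop :=
  ∃ A B C D : List V, A ≠ [] ∧ B ≠ [] ∧ D ≠ [] ∧
    L = A ++ B ++ C ++ D ∧ M = A.reverse ++ B.reverse ++ D ++ C.reverse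

/-- A γ-move applied up to equivalence: the ordering may first be replaced by
any equivalent ordering. -/
def GammaStep (L M : List V) : Prop := ∃ L', OrderEquiv L L' ∧ GammaMove L' M

/-- A κ-move applied up to equivalence. -/
def KappaStep (L M : List V) : Prop := ∃ L', OrderEquiv L L' ∧ KappaMove L' M

/-- `M` is obtained from `L` by applying at most one κ-move and at most one
γ-move (in some order), each up to equivalence. -/
def KGStep (L M : List V) : Prop :=
  OrderEquiv L M ∨ GammaStep L M ∨ KappaStep L M ∨
    (∃ K, KappaStep L K ∧ GammaStep K M) ∨
    (∃ K, GammaStep L K ∧ KappaStep K M)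


/-- The consecutive pairs of a list, read as a path. -/
def pathPairs : List V → List (Sym2 V)
  | [] => []
  | [_] => []
  | a :: b :: l => s(a, b) :: pathPairs (b :: l)

theorem pathPairs_append : ∀ {X Y : List V} {a b : V}, X.getLast? = some a → Y.head? = some b →
    pathPairs (X ++ Y) = pathPairs X ++ s(a, b) :: pathPairs Y
  | [], _, _, _, h, _ => by simp at h
  | [c], [], _, _, _, h => by simp at h
  | [c], d :: Y, a, b, h, h' => by
    simp only [List.getLast?_singleton, Option.some.injEq, List.head?_cons] at h h'
    subst h h'
    simp [pathPairs]
  | c :: d :: X, Y, a, b, h, h' => by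
    have := pathPairs_append (X := d :: X) (by simpa using h) h'
    simpa [pathPairs] using this

theorem pathPairs_reverse_perm : ∀ X : List V, (pathPairs X.reverse).Perm (pathPairs X)
  | [] => by simp [pathPairs]
  | [a] => by simp [pathPairs]
  | a :: b :: l => by
    rw [List.reverse_cons,
      pathPairs_append (a := b) (b := a) (by simp) (by simp)]
    simp only [pathPairs]
    rw [Sym2.eq_swap]
    exact List.perm_append_singleton _ _ |>.trans ((pathPairs_reverse_perm (b :: l)).cons _)

theorem adjPairs_eq_pathPairs {X : List V} {a : V} (h : X.head? = some a) :
    adjPairs X = pathPairs (X ++ [a]) := by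
  have aux : ∀ (l : List V) (c : V),
      ((c :: l).zip (l ++ [a])).map (fun p => s(p.1, p.2)) = pathPairs (c :: (l ++ [a])) := by
    intro l
    induction l with
    | nil => intro c; simp [pathPairs]
    | cons d l ih => intro c; simp [pathPairs, ← ih d]
  cases X with
  | nil => simp at h
  | cons c l =>
    simp only [List.head?_cons, Option.some.injEq] at h
    subst h
    simpa [adjPairs] using aux l c

theorem length_adjPairs (L : List V) : (adjPairs L).length = L.length := by
  simp [adjPairs]

theorem adjPairs_rotate (L : List V) (k : ℕ) : adjPairs (L.rotate k) = (adjPairs L).rotate k := by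
  rw [adjPairs, adjPairs, ← List.map_rotate, List.rotate_rotate, Nat.add_comm,
    ← List.rotate_rotate, List.zip_eq_zipWith, List.zip_eq_zipWith,
    List.zipWith_rotate_distrib _ _ _ _ (by simp)]

theorem adjPairs_perm_of_isRotated {L M : List V} (h : L ~r M) :
    (adjPairs L).Perm (adjPairs M) := by
  obtain ⟨k, rfl⟩ := h
  rw [adjPairs_rotate]
  exact (List.rotate_perm _ _).symm

theorem adjPairs_append_perm {X Y : List V} {a a' b b' : V} (ha : X.head? = some a)
    (ha' : X.getLast? = some a') (hb : Y.head? = some b) (hb' : Y.getLast? = some b') :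
    (adjPairs (X ++ Y)).Perm (s(a', b) :: s(b', a) :: (pathPairs X ++ pathPairs Y)) := by
  rw [adjPairs_eq_pathPairs (a := a) (by simp [ha]),
    pathPairs_append (a := b') (b := a) (by simp [hb']) (by simp), pathPairs_append ha' hb]
  simp only [pathPairs]
  classical
  rw [List.perm_iff_count]
  intro e
  simp only [List.count_cons, List.count_append, List.count_nil]
  omega

theorem adjPairs_gamma_perm {X Y : List V} {a a' b b' : V} (ha : X.head? = some a)
    (ha' : X.getLast? = some a') (hb : Y.head? = some b) (hb' : Y.getLast? = some b') :
    (s(a', b) :: s(b', a) :: adjPairs (X.reverse ++ Y)).Perm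
      (s(a, b) :: s(b', a') :: adjPairs (X ++ Y)) := by
  have h₁ := adjPairs_append_perm ha ha' hb hb'
  have h₂ := adjPairs_append_perm (X := X.reverse) (Y := Y) (by simpa using ha')
    (by simpa using ha) hb hb'
  have h₃ := pathPairs_reverse_perm X
  classical
  rw [List.perm_iff_count] at *
  intro e
  have e₁ := h₁ e
  have e₂ := h₂ e
  have e₃ := h₃ e
  simp only [List.count_cons, List.count_append] at *
  omega

/-- The number of adjacent pairs of `L` lying in `H`. -/
noncomputable def numIn (H : Set (Sym2 V)) (L : List V) : ℕ :=
  (adjPairs L).countP (fun e => @decide (e ∈ H) (Classical.propDecidable _))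

theorem numIn_eq_of_isRotated (H : Set (Sym2 V)) {L M : List V} (h : L ~r M) :
    numIn H L = numIn H M :=
  (adjPairs_perm_of_isRotated h).countP_eq _

theorem numGaps_eq_numIn (G : SimpleGraph V) (L : List V) :
    numGaps G L = numIn G.edgeSetᶜ L := rfl

open Classical in
theorem numIn_gamma (H : Set (Sym2 V)) {X Y : List V} {a a' b b' : V} (ha : X.head? = some a)
    (ha' : X.getLast? = some a') (hb : Y.head? = some b) (hb' : Y.getLast? = some b') :
    numIn H (X.reverse ++ Y) + (if s(a', b) ∈ H then 1 else 0) + (if s(b', a) ∈ H then 1 else 0) =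
      numIn H (X ++ Y) + (if s(a, b) ∈ H then 1 else 0) + (if s(b', a') ∈ H then 1 else 0) := by
  have := (adjPairs_gamma_perm ha ha' hb hb').countP_eq
    (fun e => @decide (e ∈ H) (Classical.propDecidable _))
  simp only [List.countP_cons, decide_eq_true_eq] at this
  unfold numIn
  omega

theorem OrderEquiv.of_isRotated {L M : List V} (h : L ~r M) : OrderEquiv L M := by
  obtain ⟨k, hk⟩ := h
  exact .inl ⟨k, hk.symm⟩

/-- A reversal of a segment whose two boundary pairs lie outside `H`, creating a pair in `H`. -/
theorem exists_gammaStep_of_boundary_notMem {G : SimpleGraph V} {H : Set (Sym2 V)}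
    (hH : H ⊆ G.edgeSet) {L X Y : List V} {a a' b b' : V} (hL : L ~r X ++ Y)
    (ha : X.head? = some a) (ha' : X.getLast? = some a') (hb : Y.head? = some b)
    (hb' : Y.getLast? = some b') (h₁ : s(a', b) ∉ H) (h₂ : s(b', a) ∉ H)
    (h₃ : s(a, b) ∈ H ∨ s(b', a') ∈ H) :
    ∃ M, GammaStep L M ∧ M.Perm L ∧ numIn H L + 1 ≤ numIn H M ∧
      numGaps G M ≤ numGaps G L + 1 := by
  refine ⟨X.reverse ++ Y, ⟨X ++ Y, .of_isRotated hL, X, Y, ?_, ?_, rfl, rfl⟩,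
    (X.reverse_perm.append_right Y).trans hL.perm.symm, ?_, ?_⟩
  · rintro rfl; simp at ha
  · rintro rfl; simp at hb
  · have := numIn_gamma H ha ha' hb hb'
    rw [numIn_eq_of_isRotated H hL]
    grind
  · have := numIn_gamma G.edgeSetᶜ ha ha' hb hb'
    have h₃' := h₃.imp (@hH _) (@hH _)
    simp only [numGaps_eq_numIn]
    rw [numIn_eq_of_isRotated G.edgeSetᶜ hL]
    grind

theorem exists_isRotated_of_mem_adjPairs {L : List V} (hL : 2 ≤ L.length) {e : Sym2 V}
    (he : e ∈ adjPairs L) : ∃ x y T, L ~r x :: y :: T ∧ e = s(x, y) := by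
  obtain ⟨i, hi, rfl⟩ := List.mem_iff_getElem.1 he
  have h₁ := List.head?_rotate hi
  rw [← adjPairs_rotate, List.getElem?_eq_getElem hi] at h₁
  have h₂ : L ~r L.rotate i := ⟨i, rfl⟩
  rw [← List.length_rotate L i] at hL
  match hM : L.rotate i, hL with
  | x :: y :: T, _ =>
    rw [hM] at h₁ h₂
    refine ⟨x, y, T, h₂, ?_⟩
    rw [adjPairs_eq_pathPairs (a := x) (by simp)] at h₁
    simpa [pathPairs] using h₁.symm

theorem exists_append_of_mem {P : V → Prop} {l : List V} {b : V} (hb : b ∈ l) (hP : P b) :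
    ∃ A u B, l = A ++ u :: B ∧ P u ∧ ∀ a ∈ A, ¬ P a := by
  classical
  obtain ⟨u, hu⟩ := Option.isSome_iff_exists.1
    (List.find?_isSome (p := fun a => decide (P a)).2 ⟨b, hb, by simpa⟩)
  obtain ⟨h, A, B, rfl, hA⟩ := List.find?_eq_some_iff_append.1 hu
  exact ⟨A, u, B, rfl, by simpa using h, by simpa using hA⟩

theorem mem_of_getLast?_getD (l : List V) (a : V) : l.getLast?.getD a ∈ a :: l := by
  cases h : l.getLast? with
  | none => simp
  | some b => simp [List.mem_of_getLast? h]

theorem mem_of_head?_getD (l : List V) (a : V) : l.head?.getD a ∈ a :: l := by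
  cases l <;> simp

/-- In a connected 2-regular edge set `H`, one or two segment reversals bring a circle ordering
with a gap closer to `H`. -/
theorem exists_kgStep_numIn_lt {G : SimpleGraph V} {H : Set (Sym2 V)} (hH : H ⊆ G.edgeSet)
    (hdeg : ∀ a b c d, s(a, b) ∈ H → s(a, c) ∈ H → s(a, d) ∈ H → b ≠ c → b ≠ d → c ≠ d → False)
    (hnbr : ∀ a, ∃ b c, b ≠ c ∧ s(a, b) ∈ H ∧ s(a, c) ∈ H)
    (hconn : ∀ (S : Set V) (a b : V), a ∈ S → b ∉ S → ∃ p ∈ S, ∃ q, q ∉ S ∧ s(p, q) ∈ H)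
    {L : List V} (hL : 2 ≤ L.length) (hnd : L.Nodup) (hmem : ∀ a, a ∈ L) (hg : 1 ≤ numGaps G L) :
    ∃ M, KGStep L M ∧ M.Perm L ∧ numIn H L + 1 ≤ numIn H M ∧ numGaps G M ≤ numGaps G L + 1 := by
  have of_gamma : (∃ M, GammaStep L M ∧ M.Perm L ∧ numIn H L + 1 ≤ numIn H M ∧
      numGaps G M ≤ numGaps G L + 1) → ∃ M, KGStep L M ∧ M.Perm L ∧ numIn H L + 1 ≤ numIn H M ∧
      numGaps G M ≤ numGaps G L + 1 := fun ⟨M, h, h'⟩ => ⟨M, .inr (.inl h), h'⟩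
  have irrefl : ∀ a, s(a, a) ∉ H := fun a h => G.irrefl (hH h)
  have symm : ∀ {a b}, s(a, b) ∈ H → s(b, a) ∈ H := fun h => Sym2.eq_swap ▸ h
  obtain ⟨e, he, heG⟩ : ∃ e ∈ adjPairs L, e ∉ G.edgeSet := by
    simpa [numGaps, Nat.one_le_iff_ne_zero] using hg
  obtain ⟨x, y, T, hrot, rfl⟩ := exists_isRotated_of_mem_adjPairs hL he
  have hxy : s(x, y) ∉ H := fun h => heG (hH h)
  rw [hrot.nodup_iff] at hnd
  simp only [hrot.mem_iff] at hmem
  obtain ⟨A', u, B, hB, rfl, hxu, hA'⟩ : ∃ A' u B, B ≠ [] ∧ T = A' ++ u :: B ∧ s(x, u) ∈ H ∧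
      ∀ a ∈ A', s(x, a) ∉ H := by
    obtain ⟨b, c, hbc, hb, hc⟩ := hnbr x
    have hT : ∀ d, s(x, d) ∈ H → d ∈ T := by
      intro d hd
      have := hmem d
      grind
    obtain ⟨A', u, B, rfl, hu, hA'⟩ := exists_append_of_mem (P := fun a => s(x, a) ∈ H) (hT b hb) hb
    refine ⟨A', u, B, ?_, rfl, hu, hA'⟩
    rintro rfl
    have := hT b hb
    have := hT c hc
    grind
  obtain ⟨A, hAy, hA0⟩ : ∃ A, A = y :: A' ∧ A ≠ [] := ⟨_, rfl, by simp⟩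
  have hAh : A.head? = some y := by simp [hAy]
  have hA : ∀ a ∈ A, s(x, a) ∉ H := by grind
  have hL₀ : x :: y :: (A' ++ u :: B) = x :: (A ++ u :: B) := by simp [hAy]
  rw [hL₀] at hrot hnd
  simp only [hL₀] at hmem
  clear hL₀ hA'
  obtain ⟨v, B', rfl⟩ := List.exists_cons_of_ne_nil hB
  generalize hBv : v :: B' = B at *
  have hBh : B.head? = some v := by simp [← hBv]
  have hrot₁ : L ~r (A ++ [u]) ++ (B ++ [x]) :=
    hrot.trans ⟨1, by simp⟩
  by_cases huv : s(u, v) ∈ H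
  swap
  · exact of_gamma <| exists_gammaStep_of_boundary_notMem hH hrot₁ (a := y) (a' := u) (b := v)
      (b' := x) (by simp [hAh]) (by simp) (by simp [hBh]) (by simp) huv hxy (.inr hxu)
  have hM₁ : ((A ++ [u]).reverse ++ (B ++ [x])) ~r x :: u :: (A.reverse ++ B) := by
    refine .symm ⟨1, by simp⟩
  have hin := fun H => numIn_gamma H (X := A ++ [u]) (Y := B ++ [x]) (a := y) (a' := u) (b := v)
    (b' := x) (by simp [hAh]) (by simp) (by simp [hBh]) (by simp)
  simp only [← numIn_eq_of_isRotated _ hrot₁] at hin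
  have hxyG : s(x, y) ∈ G.edgeSetᶜ := heG
  have hxuG : s(x, u) ∉ G.edgeSetᶜ := fun h => h (hH hxu)
  have hinH := hin H
  have hinG := hin G.edgeSetᶜ
  simp only [huv, hxy, hxu, hxyG, hxuG, if_true, if_false] at hinH hinG
  by_cases hyv : s(y, v) ∈ H
  · have hyvG : s(y, v) ∉ G.edgeSetᶜ := fun h => h (hH hyv)
    simp only [hyv, hyvG, if_true, if_false] at hinH hinG
    refine of_gamma ⟨_, ⟨_, .of_isRotated hrot₁, _, _, ?_, ?_, rfl, rfl⟩, ?_, ?_, ?_⟩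
    · simp
    · simp
    · exact ((List.reverse_perm _).append_right _).trans hrot₁.perm.symm
    · omega
    · simp only [numGaps_eq_numIn]; omega
  have hκ : KappaStep L (x :: u :: (A.reverse ++ B)) :=
    ⟨_, .of_isRotated hrot, [x], A ++ [u], [], B, by simp, by simp, by simp [← hBv], by simp,
      by simp⟩
  have of_two : (∃ M, GammaStep (x :: u :: (A.reverse ++ B)) M ∧
      M.Perm (x :: u :: (A.reverse ++ B)) ∧ numIn H (x :: u :: (A.reverse ++ B)) + 1 ≤ numIn H M ∧
      numGaps G M ≤ numGaps G (x :: u :: (A.reverse ++ B)) + 1) →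
      ∃ M, KGStep L M ∧ M.Perm L ∧ numIn H L + 1 ≤ numIn H M ∧
      numGaps G M ≤ numGaps G L + 1 := by
    rintro ⟨M, h, hp, h₁, h₂⟩
    refine ⟨M, .inr (.inr (.inr (.inl ⟨_, hκ, h⟩))), ?_, ?_, ?_⟩
    · exact hp.trans <| hM₁.perm.symm.trans <|
        ((List.reverse_perm _).append_right _).trans hrot₁.perm.symm
    · rw [← numIn_eq_of_isRotated _ hM₁] at h₁
      omega
    · simp only [numGaps_eq_numIn] at h₂ ⊢
      rw [← numIn_eq_of_isRotated _ hM₁] at h₂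
      grind
  obtain ⟨p, hpA, q, hqA, hpq⟩ := hconn {a | a ∈ A} y x (by simp [hAy]) (by simp; grind)
  simp only [Set.mem_ofPred_eq] at hpA hqA
  have hqx : q ≠ x := by rintro rfl; exact hA p hpA (symm hpq)
  have hvB : v ∈ B := by simp [← hBv]
  have hqu : q ≠ u := by
    rintro rfl
    refine hdeg q x v p (symm hxu) huv (symm hpq) ?_ ?_ ?_ <;> grind
  have hqB : q ∈ B := by
    have := hmem q
    grind
  clear hBv hin hinH hinG hM₁ hκ
  obtain ⟨A₁, A₂, rfl⟩ := List.append_of_mem hpA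
  obtain ⟨B₁, B₂, rfl⟩ := List.append_of_mem hqB
  have hpm := mem_of_getLast?_getD A₁ x
  have hpn := mem_of_head?_getD A₂ u
  have hqm := mem_of_getLast?_getD B₁ u
  have hqn := mem_of_head?_getD B₂ x
  obtain ⟨pm, hpm'⟩ : ∃ z, A₁.getLast?.getD x = z := ⟨_, rfl⟩
  obtain ⟨pn, hpn'⟩ : ∃ z, A₂.head?.getD u = z := ⟨_, rfl⟩
  obtain ⟨qm, hqm'⟩ : ∃ z, B₁.getLast?.getD u = z := ⟨_, rfl⟩
  obtain ⟨qn, hqn'⟩ : ∃ z, B₂.head?.getD x = z := ⟨_, rfl⟩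
  rw [hpm'] at hpm
  rw [hpn'] at hpn
  rw [hqm'] at hqm
  rw [hqn'] at hqn
  have hnd' : ((A₁ ++ p :: A₂ ++ u :: B₁) ++ (q :: B₂ ++ [x])).Nodup := by
    have := hrot₁.nodup_iff.1 (hrot.nodup_iff.2 hnd)
    simpa only [List.append_assoc, List.cons_append, List.nil_append] using this
  have hp : s(p, pm) ∉ H ∨ s(p, pn) ∉ H := by
    by_contra! h
    have h₁ := (List.nodup_append (l₁ := x :: A₁) (l₂ := p :: A₂ ++ u :: (B₁ ++ q :: B₂))).1
      (by simpa only [List.append_assoc, List.cons_append] using hnd) |>.2.2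
    have h₂ := (List.nodup_append.1 hnd').2.2
    refine hdeg p pm pn q h.1 h.2 hpq (h₁ _ hpm _ ?_) (h₁ _ hpm _ (by simp))
      (h₂ _ ?_ _ (by simp)) <;> clear * - hpn <;> grind
  have hq : s(q, qm) ∉ H ∨ s(q, qn) ∉ H := by
    by_contra! h
    have h₁ := (List.nodup_append (l₁ := x :: (A₁ ++ p :: A₂)) (l₂ := u :: (B₁ ++ q :: B₂))).1
      hnd |>.2.2
    have h₂ := (List.nodup_append.1 hnd').2.2
    refine hdeg q qm qn p h.1 h.2 (symm hpq) (h₂ _ ?_ _ ?_) (h₁ _ (by simp) _ ?_).symm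
      (h₂ _ (by simp) _ ?_).symm <;> clear * - hqm hqn <;> grind
  by_cases hpp : s(p, pn) ∈ H <;> by_cases hqq : s(q, qn) ∈ H
  · have hp := hp.resolve_right (not_not.2 hpp)
    have hq := hq.resolve_right (not_not.2 hqq)
    refine of_gamma <| exists_gammaStep_of_boundary_notMem hH
      (X := p :: (A₂ ++ u :: B₁)) (Y := q :: (B₂ ++ x :: A₁))
      (a := p) (a' := qm) (b := q) (b' := pm) (hrot.trans ?_) ?_ ?_ ?_ ?_ ?_ ?_ (.inl hpq)
    · exact ⟨(x :: A₁).length, by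
        rw [show x :: (A₁ ++ p :: A₂ ++ u :: (B₁ ++ q :: B₂)) =
          (x :: A₁) ++ (p :: (A₂ ++ u :: B₁) ++ q :: B₂) by simp, List.rotate_append_length_eq]
        simp⟩
    · simp
    · simp [List.getLast?_cons, hqm']
    · simp
    · simp [List.getLast?_cons, hpm']
    · exact fun h => hq (symm h)
    · exact fun h => hp (symm h)
  · have hp := hp.resolve_right (not_not.2 hpp)
    refine of_two <| exists_gammaStep_of_boundary_notMem hH
      (X := A₁.reverse ++ B₁ ++ [q]) (Y := B₂ ++ x :: u :: (A₂.reverse ++ [p]))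
      (a := A₁.getLast?.getD v) (a' := q) (b := qn) (b' := p) ?_ ?_ ?_ ?_ ?_ hqq ?_ (.inr hpq)
    · exact ⟨(x :: u :: (A₂.reverse ++ [p])).length, by
        rw [show x :: u :: ((A₁ ++ p :: A₂).reverse ++ (B₁ ++ q :: B₂)) =
          (x :: u :: (A₂.reverse ++ [p])) ++ (A₁.reverse ++ B₁ ++ [q] ++ B₂) by simp,
          List.rotate_append_length_eq]
        simp⟩
    · cases h : A₁.getLast? with
      | none =>
        simp only [List.getLast?_eq_none_iff] at h
        subst h
        simpa using hBh
      | some z => simp [h]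
    · simp
    · simp [hqn']
    · simp [List.getLast?_cons]
    · cases h : A₁.getLast? with
      | none =>
        simp only [List.getLast?_eq_none_iff] at h
        subst h
        simp at hAh
        simpa [hAh] using hyv
      | some z =>
        simp only [h, Option.getD_some] at hpm' ⊢
        rwa [hpm']
  · have hq := hq.resolve_right (not_not.2 hqq)
    have hB₁ : B₁ ≠ [] := by
      rintro rfl
      simp at hBh hqm'
      subst hBh hqm'
      exact hq (symm huv)
    refine of_two <| exists_gammaStep_of_boundary_notMem hH
      (X := p :: (A₁.reverse ++ B₁)) (Y := q :: (B₂ ++ x :: u :: A₂.reverse))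
      (a := p) (a' := qm) (b := q) (b' := pn) ?_ ?_ ?_ ?_ ?_ ?_ ?_ (.inl hpq)
    · exact ⟨(x :: u :: A₂.reverse).length, by
        rw [show x :: u :: ((A₁ ++ p :: A₂).reverse ++ (B₁ ++ q :: B₂)) =
          (x :: u :: A₂.reverse) ++ (p :: (A₁.reverse ++ B₁) ++ q :: B₂) by simp,
          List.rotate_append_length_eq]
        simp⟩
    · simp
    · obtain ⟨B₃, z, rfl⟩ := List.eq_nil_or_concat' B₁ |>.resolve_left hB₁
      simp at hqm'
      simp [List.getLast?_cons, hqm']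
    · simp
    · simp [List.getLast?_cons, hpn']
    · exact fun h => hq (symm h)
    · exact fun h => hpp (symm h)
  · refine of_gamma <| exists_gammaStep_of_boundary_notMem hH
      (X := A₂ ++ u :: (B₁ ++ [q])) (Y := B₂ ++ x :: (A₁ ++ [p]))
      (a := pn) (a' := q) (b := qn) (b' := p) (hrot.trans ?_) ?_ ?_ ?_ ?_ hqq hpp (.inr hpq)
    · exact ⟨(x :: (A₁ ++ [p])).length, by
        rw [show x :: (A₁ ++ p :: A₂ ++ u :: (B₁ ++ q :: B₂)) =
          (x :: (A₁ ++ [p])) ++ (A₂ ++ u :: (B₁ ++ [q]) ++ B₂) by simp,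
          List.rotate_append_length_eq]
        simp⟩
    · simp [hpn']
    · simp [List.getLast?_cons]
    · simp [hqn']
    · simp [List.getLast?_cons]

namespace SimpleGraph.Walk.IsHamiltonianCycle

variable [DecidableEq V] {G : SimpleGraph V} {v : V} {p : G.Walk v v}

theorem ncard_setOf_mem_edges (hp : p.IsHamiltonianCycle) (a : V) :
    {b | s(a, b) ∈ p.edges}.ncard = 2 := by
  rw [← hp.isCycle.ncard_neighborSet_toSubgraph_eq_two (hp.mem_support a)]
  congr 1
  ext b
  rw [Subgraph.mem_neighborSet, ← Subgraph.mem_edgeSet, mem_edges_toSubgraph]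
  rfl

theorem eq_or_eq_or_eq_of_mem_edges (hp : p.IsHamiltonianCycle) {a b c d : V}
    (hb : s(a, b) ∈ p.edges) (hc : s(a, c) ∈ p.edges) (hd : s(a, d) ∈ p.edges) :
    b = c ∨ b = d ∨ c = d := by
  obtain ⟨e, f, -, h⟩ := Set.ncard_eq_two.1 (hp.ncard_setOf_mem_edges a)
  simp only [Set.ext_iff, Set.mem_ofPred_eq, Set.mem_insert_iff, Set.mem_singleton_iff] at h
  grind

theorem exists_mem_edges_boundary (hp : p.IsHamiltonianCycle) {S : Set V} {a b : V}
    (ha : a ∈ S) (hb : b ∉ S) : ∃ c ∈ S, ∃ d, d ∉ S ∧ s(c, d) ∈ p.edges := by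
  by_cases hv : v ∈ S
  · obtain ⟨d, hd, h₁, h₂⟩ := (p.takeUntil b (hp.mem_support b)).exists_boundary_dart S hv hb
    exact ⟨_, h₁, _, h₂, p.edges_takeUntil_subset_edges _ (List.mem_map_of_mem hd)⟩
  · obtain ⟨d, hd, h₁, h₂⟩ :=
      (p.takeUntil a (hp.mem_support a)).exists_boundary_dart Sᶜ hv (by simpa)
    refine ⟨_, not_not.1 h₂, _, h₁, Sym2.eq_swap ▸ ?_⟩
    exact p.edges_takeUntil_subset_edges _ (List.mem_map_of_mem hd)

end SimpleGraph.Walk.IsHamiltonianCycle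

/-- from any circle ordering with at least one gap there exists
an ordering, reachable by at most one κ-move and at most one γ-move, whose
distance to the Hamiltonian cycle `H` decreases by at least 1 while the number
of gaps grows by at most 1; consequently `Δ` decreases by at least `2/3`. -/
theorem stmt3 [Fintype V] [DecidableEq V] (G : SimpleGraph V)
    (hn : 3 ≤ Fintype.card V)
    {v : V} (p : G.Walk v v) (hp : p.IsHamiltonianCycle)
    (L : List V) (hL : IsCircleOrdering L) (hg : 1 ≤ numGaps G L) :
    ∃ M : List V, IsCircleOrdering M ∧ KGStep L M ∧
      distTo {e | e ∈ p.edges} M + 1 ≤ distTo {e | e ∈ p.edges} L ∧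
      numGaps G M ≤ numGaps G L + 1 ∧
      delta G {e | e ∈ p.edges} M ≤ delta G {e | e ∈ p.edges} L - 2/3 := by
  have hlen : L.length = Fintype.card V := by
    rw [← List.toFinset_card_of_nodup hL.1, ← Finset.card_univ]
    congr
    ext a
    simp [hL.2 a]
  obtain ⟨M, hM, hperm, h₁, h₂⟩ := exists_kgStep_numIn_lt (G := G) (H := {e | e ∈ p.edges})
    (fun e he => p.edges_subset_edgeSet he)
    (fun a b c d hb hc hd h h' h'' => by
      have := hp.eq_or_eq_or_eq_of_mem_edges hb hc hd
      tauto)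
    (fun a => by
      obtain ⟨b, c, hbc, h⟩ := Set.ncard_eq_two.1 (hp.ncard_setOf_mem_edges a)
      exact ⟨b, c, hbc, (Set.ext_iff.1 h b).2 (by simp), (Set.ext_iff.1 h c).2 (by simp)⟩)
    (fun S a b ha hb => hp.exists_mem_edges_boundary ha hb) (by omega) hL.1 hL.2 hg
  have hdist : distTo {e | e ∈ p.edges} M + 1 ≤ distTo {e | e ∈ p.edges} L := by
    have h₃ : numIn {e | e ∈ p.edges} M ≤ M.length := by
      rw [← length_adjPairs M]
      exact List.countP_le_length
    have := hperm.length_eq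
    change M.length - numIn _ M + 1 ≤ L.length - numIn _ L
    omega
  refine ⟨M, ⟨hperm.nodup_iff.2 hL.1, fun a => hperm.mem_iff.2 (hL.2 a)⟩, hM, hdist, h₂, ?_⟩
  have hdist' : (distTo {e | e ∈ p.edges} M : ℚ) + 1 ≤ distTo {e | e ∈ p.edges} L := by
    exact_mod_cast hdist
  have h₂' : (numGaps G M : ℚ) ≤ numGaps G L + 1 := by exact_mod_cast h₂
  unfold delta
  linarith
end

section
/- Let G be a simple graph on n ≥ 3 vertices, let H be a Hamiltonian cycle of G, and let L be a circle ordering of G with g(L) = 0 whose set of adjacent pairs is not equal to the edge set of H. Then there exists a circle ordering L′ obtained from L by applying at most one κ-move and at most one γ-move (in some order) such that dist(L′, H) ≤ dist(L, H) − 1 and g(L′) ≤ 2; consequently Δ(L′, H) ≤ Δ(L, H) − 1/3. -/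
variable {V : Type*}

theorem pathPairs_append_cons_cons (A B : List V) (a b : V) :
    pathPairs (A ++ a :: b :: B) = pathPairs (A ++ [a]) ++ s(a, b) :: pathPairs (b :: B) := by
  induction A with
  | nil => simp [pathPairs]
  | cons c A ih => cases A with
    | nil => simp [pathPairs]
    | cons d A => simpa [pathPairs] using ih

theorem pathPairs_append_s5 {A B : List V} (hA : A ≠ []) (hB : B ≠ []) :
    pathPairs (A ++ B) = pathPairs A ++ s(A.getLast hA, B.head hB) :: pathPairs B := by
  obtain ⟨b, B, rfl⟩ := List.exists_cons_of_ne_nil hB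
  rcases List.eq_nil_or_concat A with rfl | ⟨A, a, rfl⟩
  · exact absurd rfl hA
  · simpa using pathPairs_append_cons_cons A B a b

theorem pathPairs_reverse_perm_s5 (A : List V) : (pathPairs A.reverse).Perm (pathPairs A) := by
  induction A with
  | nil => simp [pathPairs]
  | cons a A ih =>
    by_cases hA : A = []
    · subst hA; simp [pathPairs]
    · obtain ⟨b, A, rfl⟩ := List.exists_cons_of_ne_nil hA
      rw [List.reverse_cons, pathPairs_append_s5 (by simp) (by simp)]
      simpa [pathPairs, Sym2.eq_swap] using
        (List.perm_append_singleton s(a, b) _).trans (ih.cons s(a, b))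

theorem map_zip_append_singleton (a c : V) (l : List V) :
    ((a :: l).zip (l ++ [c])).map (fun p => s(p.1, p.2)) = pathPairs (a :: l ++ [c]) := by
  induction l generalizing a with
  | nil => simp [pathPairs]
  | cons b l ih => simpa [pathPairs] using ih b

theorem adjPairs_eq {L : List V} (h : L ≠ []) :
    adjPairs L = pathPairs L ++ [s(L.getLast h, L.head h)] := by
  obtain ⟨a, l, rfl⟩ := List.exists_cons_of_ne_nil h
  have := map_zip_append_singleton a a l
  rw [pathPairs_append_s5 (by simp) (by simp)] at this
  simpa [adjPairs, pathPairs] using this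

theorem adjPairs_append {A B : List V} (hA : A ≠ []) (hB : B ≠ []) :
    adjPairs (A ++ B) = pathPairs A ++ s(A.getLast hA, B.head hB) :: pathPairs B ++
      [s(B.getLast hB, A.head hA)] := by
  rw [adjPairs_eq (by simp [hA]), pathPairs_append_s5 hA hB]
  simp [hA, hB, List.getLast_append_of_ne_nil, List.head_append_of_ne_nil]

theorem isRotated_append_comm (A B : List V) : A ++ B ~r B ++ A :=
  ⟨A.length, by simp⟩

theorem IsCircleOrdering.of_perm [Fintype V] {L M : List V} (hL : IsCircleOrdering L)
    (h : L.Perm M) : IsCircleOrdering M :=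
  ⟨h.nodup_iff.1 hL.1, fun v => h.mem_iff.1 (hL.2 v)⟩

/-- A list of at most three new pairs containing an edge of `H ⊆ G`, replacing pairs outside `H`
in a gap-free ordering, decreases the distance to `H` and creates at most two gaps. -/
theorem improvement_of_exchange {G : SimpleGraph V} {H : Set (Sym2 V)} (hHG : H ⊆ G.edgeSet)
    {L M : List V} (hg : numGaps G L = 0) (hlen : M.length = L.length)
    {W R N : List (Sym2 V)} (hLW : (adjPairs L).Perm (W ++ R)) (hMW : (adjPairs M).Perm (W ++ N))
    (hR : ∀ e ∈ R, e ∉ H) (hN : N.length ≤ 3) {e : Sym2 V} (heN : e ∈ N) (heH : e ∈ H) :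
    distTo H M + 1 ≤ distTo H L ∧ numGaps G M ≤ 2 ∧ delta G H M ≤ delta G H L - 1 / 3 := by
  have hgM : numGaps G M ≤ 2 := by
    unfold numGaps at hg ⊢
    rw [hLW.countP_eq, List.countP_append] at hg
    rw [hMW.countP_eq, List.countP_append]
    have hlt : N.countP (fun e => @decide (e ∉ G.edgeSet) (Classical.propDecidable _))
        < N.length := by
      refine lt_of_le_of_ne List.countP_le_length fun h => ?_
      have := List.countP_eq_length.1 h e heN
      simp only [decide_eq_true_eq] at this
      exact this (hHG heH)
    omega
  have hd : distTo H M + 1 ≤ distTo H L := by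
    have hM := length_adjPairs M
    unfold distTo
    rw [hLW.countP_eq, hMW.countP_eq, List.countP_append, List.countP_append]
    rw [hMW.length_eq, List.length_append] at hM
    have h0 : R.countP (fun e => @decide (e ∈ H) (Classical.propDecidable _)) = 0 := by
      rw [List.countP_eq_zero]
      intro e he
      simpa using hR e he
    have h1 : 0 < N.countP (fun e => @decide (e ∈ H) (Classical.propDecidable _)) := by
      rw [List.countP_pos_iff]
      exact ⟨e, heN, by simpa using heH⟩
    have h2 : W.countP (fun e => @decide (e ∈ H) (Classical.propDecidable _)) ≤ W.length :=
      List.countP_le_length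
    have h3 : N.countP (fun e => @decide (e ∈ H) (Classical.propDecidable _)) ≤ N.length :=
      List.countP_le_length
    omega
  refine ⟨hd, hgM, ?_⟩
  have h1 : (distTo H M : ℚ) + 1 ≤ distTo H L := by exact_mod_cast hd
  have h2 : (numGaps G M : ℚ) ≤ 2 := by exact_mod_cast hgM
  simp only [delta, hg, Nat.cast_zero]
  linarith

/-- Reversing one of two complementary arcs improves the ordering when both pairs between the
arcs are outside `H` and one of the created pairs is in `H`. -/
theorem exists_improvement_of_reverse [Fintype V] {G : SimpleGraph V} {H : Set (Sym2 V)}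
    (hHG : H ⊆ G.edgeSet) {L A B : List V} (hL : IsCircleOrdering L) (hg : numGaps G L = 0)
    (hA : A ≠ []) (hB : B ≠ []) (hrot : L ~r A ++ B)
    (h₁ : s(A.getLast hA, B.head hB) ∉ H) (h₂ : s(B.getLast hB, A.head hA) ∉ H)
    (h : s(A.head hA, B.head hB) ∈ H ∨ s(B.getLast hB, A.getLast hA) ∈ H) :
    ∃ M : List V, IsCircleOrdering M ∧ KGStep L M ∧ distTo H M + 1 ≤ distTo H L ∧
      numGaps G M ≤ 2 ∧ delta G H M ≤ delta G H L - 1 / 3 := by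
  have hperm : L.Perm (A.reverse ++ B) :=
    hrot.perm.trans ((List.reverse_perm A).symm.append_right B)
  refine ⟨A.reverse ++ B, hL.of_perm hperm,
    Or.inr (Or.inl ⟨_, .of_isRotated hrot, A, B, hA, hB, rfl, rfl⟩), ?_⟩
  have hW : (adjPairs L).Perm ((pathPairs A ++ pathPairs B) ++
      [s(A.getLast hA, B.head hB), s(B.getLast hB, A.head hA)]) := by
    refine (adjPairs_perm_of_isRotated hrot).trans ?_
    rw [adjPairs_append hA hB]
    classical
    rw [List.perm_iff_count]
    intro e
    simp only [List.count_append, List.count_cons, List.count_nil]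
    omega
  have hM : (adjPairs (A.reverse ++ B)).Perm ((pathPairs A ++ pathPairs B) ++
      [s(A.head hA, B.head hB), s(B.getLast hB, A.getLast hA)]) := by
    rw [adjPairs_append (by simpa using hA) hB]
    classical
    rw [List.perm_iff_count]
    intro e
    simp only [List.count_append, List.count_cons, List.count_nil,
      (pathPairs_reverse_perm_s5 A).count_eq, List.getLast_reverse, List.head_reverse]
    omega
  have hR : ∀ e ∈ [s(A.getLast hA, B.head hB), s(B.getLast hB, A.head hA)], e ∉ H := by
    simp [h₁, h₂]
  rcases h with h | h
  · exact improvement_of_exchange hHG hg hperm.length_eq.symm hW hM hR (by simp) (by simp) h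
  · exact improvement_of_exchange hHG hg hperm.length_eq.symm hW hM hR (by simp) (by simp) h

/-- Exchanging two consecutive arcs improves the ordering when the three pairs between the arcs
are outside `H` and one of the created pairs is in `H`. -/
theorem exists_improvement_of_swap [Fintype V] {G : SimpleGraph V} {H : Set (Sym2 V)}
    (hHG : H ⊆ G.edgeSet) {L A B D : List V} (hL : IsCircleOrdering L) (hg : numGaps G L = 0)
    (hA : A ≠ []) (hB : B ≠ []) (hD : D ≠ []) (hrot : L ~r A ++ B ++ D)
    (h₁ : s(A.getLast hA, B.head hB) ∉ H) (h₂ : s(B.getLast hB, D.head hD) ∉ H)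
    (h₃ : s(D.getLast hD, A.head hA) ∉ H) (h : s(D.getLast hD, B.head hB) ∈ H) :
    ∃ M : List V, IsCircleOrdering M ∧ KGStep L M ∧ distTo H M + 1 ≤ distTo H L ∧
      numGaps G M ≤ 2 ∧ delta G H M ≤ delta G H L - 1 / 3 := by
  have hperm : L.Perm (B ++ A ++ D) :=
    hrot.perm.trans (List.perm_append_comm.append_right D)
  refine ⟨B ++ A ++ D, hL.of_perm hperm, Or.inr (Or.inr (Or.inr (Or.inl
    ⟨A.reverse ++ B.reverse ++ D ++ ([] : List V).reverse,
      ⟨_, .of_isRotated hrot, A, B, [], D, hA, hB, hD, by simp, rfl⟩,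
      ⟨_, .of_isRotated (List.IsRotated.refl _), A.reverse ++ B.reverse, D, by simp [hA], hD,
        by simp, by simp⟩⟩))), ?_⟩
  refine improvement_of_exchange hHG hg hperm.length_eq.symm
    (W := pathPairs A ++ pathPairs B ++ pathPairs D)
    (R := [s(A.getLast hA, B.head hB), s(B.getLast hB, D.head hD), s(D.getLast hD, A.head hA)])
    (N := [s(B.getLast hB, A.head hA), s(A.getLast hA, D.head hD), s(D.getLast hD, B.head hB)])
    ?_ ?_ (by simp [h₁, h₂, h₃]) (by simp) (by simp) h
  · refine (adjPairs_perm_of_isRotated hrot).trans ?_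
    rw [adjPairs_append (by simp [hA]) hD, pathPairs_append_s5 hA hB,
      List.getLast_append_of_ne_nil _ hB, List.head_append_of_ne_nil hA]
    classical
    rw [List.perm_iff_count]
    intro e
    simp only [List.count_append, List.count_cons, List.count_nil]
    omega
  · rw [adjPairs_append (by simp [hA]) hD, pathPairs_append_s5 hB hA,
      List.getLast_append_of_ne_nil _ hA, List.head_append_of_ne_nil hB]
    classical
    rw [List.perm_iff_count]
    intro e
    simp only [List.count_append, List.count_cons, List.count_nil]
    omega

theorem exists_append_of_not_subset {H : Set (Sym2 V)} {S : List V}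
    (h : ¬ ∀ e ∈ pathPairs S, e ∈ H) :
    ∃ (B D : List V) (hB : B ≠ []) (hD : D ≠ []), S = B ++ D ∧
      s(B.getLast hB, D.head hD) ∉ H := by
  induction S with
  | nil => simp [pathPairs] at h
  | cons a S ih => cases S with
    | nil => simp [pathPairs] at h
    | cons b S =>
      by_cases hab : s(a, b) ∈ H
      · obtain ⟨B, D, hB, hD, hS, hBD⟩ := ih fun h' => h (by simpa [pathPairs, hab] using h')
        exact ⟨a :: B, D, by simp, hD, by simp [hS], by rwa [List.getLast_cons hB]⟩
      · exact ⟨[a], b :: S, by simp, by simp, by simp, by simpa using hab⟩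

theorem head_ne_getLast {R : List V} (hR : R ≠ []) (hnd : R.Nodup) (hlen : 2 ≤ R.length) :
    R.head hR ≠ R.getLast hR := by
  obtain ⟨a, R, rfl⟩ := List.exists_cons_of_ne_nil hR
  have hR' : R ≠ [] := by rintro rfl; simp at hlen
  rw [List.getLast_cons hR', List.head_cons]
  rintro h
  exact (List.nodup_cons.1 hnd).1 (h ▸ List.getLast_mem hR')

/-- A cyclic list all of whose adjacent pairs are in `H`, where `H` has maximum degree at most
two, is closed under adjacency in `H`. -/
theorem mem_of_adjPairs_subset {H : Set (Sym2 V)}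
    (hdeg : ∀ x a b c, s(x, a) ∈ H → s(x, b) ∈ H → s(x, c) ∈ H → a = b ∨ a = c ∨ b = c)
    {S : List V} (hnd : S.Nodup) (hlen : 3 ≤ S.length) (hS : ∀ e ∈ adjPairs S, e ∈ H)
    {a b : V} (ha : a ∈ S) (hab : s(a, b) ∈ H) : b ∈ S := by
  obtain ⟨P, Q, rfl⟩ := List.append_of_mem ha
  have hrot : P ++ a :: Q ~r [a] ++ (Q ++ P) := by
    simpa using isRotated_append_comm P (a :: Q)
  have hnd' := hrot.perm.nodup_iff.1 hnd
  have hl := hrot.perm.length_eq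
  have hR : Q ++ P ≠ [] := by
    rintro h
    rw [h] at hl
    simp only [List.length_append, List.length_cons, List.length_nil] at hl hlen
    omega
  have hmem (e) (he : e ∈ adjPairs ([a] ++ (Q ++ P))) : e ∈ H :=
    hS e ((adjPairs_perm_of_isRotated hrot).mem_iff.2 he)
  rw [adjPairs_append (by simp) hR] at hmem
  have h₁ : s(a, (Q ++ P).head hR) ∈ H := hmem _ (by simp)
  have h₂ : s(a, (Q ++ P).getLast hR) ∈ H := by
    rw [Sym2.eq_swap]
    exact hmem _ (by simp)
  have hne : (Q ++ P).head hR ≠ (Q ++ P).getLast hR := by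
    refine head_ne_getLast hR (List.nodup_append.1 hnd').2.1 ?_
    simp only [List.length_append, List.length_cons, List.length_nil] at hl hlen ⊢
    omega
  have hb : b ∈ Q ++ P := by
    rcases hdeg a _ _ _ hab h₁ h₂ with h | h | h
    · exact h ▸ List.head_mem hR
    · exact h ▸ List.getLast_mem hR
    · exact absurd h hne
  exact hrot.perm.mem_iff.2 (List.mem_append_right _ hb)

/-- If `y, …, x` is an arc of a cyclic ordering whose two boundary pairs are outside `H`, while
the chord `{x, y}` is in `H`, then the ordering can be improved. -/
theorem exists_improvement_of_chord [Fintype V] {G : SimpleGraph V} {H : Set (Sym2 V)}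
    (hHG : H ⊆ G.edgeSet)
    (hdeg : ∀ x a b c, s(x, a) ∈ H → s(x, b) ∈ H → s(x, c) ∈ H → a = b ∨ a = c ∨ b = c)
    (hconn : ∀ S : Set V, (∀ a b, a ∈ S → s(a, b) ∈ H → b ∈ S) → S.Nonempty → S = Set.univ)
    {L A S : List V} (hL : IsCircleOrdering L) (hg : numGaps G L = 0)
    (hA : A ≠ []) (hS : S ≠ []) (hlen : 3 ≤ S.length) (hrot : L ~r A ++ S)
    (h₁ : s(A.getLast hA, S.head hS) ∉ H) (h₂ : s(S.getLast hS, A.head hA) ∉ H)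
    (h : s(S.getLast hS, S.head hS) ∈ H) :
    ∃ M : List V, IsCircleOrdering M ∧ KGStep L M ∧ distTo H M + 1 ≤ distTo H L ∧
      numGaps G M ≤ 2 ∧ delta G H M ≤ delta G H L - 1 / 3 := by
  have hnd := hrot.perm.nodup_iff.1 hL.1
  have hnot : ¬ ∀ e ∈ pathPairs S, e ∈ H := by
    intro hall
    have hadj : ∀ e ∈ adjPairs S, e ∈ H := by
      intro e he
      rw [adjPairs_eq hS, List.mem_append, List.mem_singleton] at he
      rcases he with he | rfl
      · exact hall e he
      · exact h
    have huniv := hconn {a | a ∈ S}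
      (fun a b ha hab => mem_of_adjPairs_subset hdeg (List.nodup_append.1 hnd).2.1 hlen hadj ha hab)
      ⟨_, List.head_mem hS⟩
    have hmem : A.head hA ∈ {a | a ∈ S} := huniv ▸ Set.mem_univ _
    exact (List.nodup_append.1 hnd).2.2 _ (List.head_mem hA) _ hmem rfl
  obtain ⟨B, D, hB, hD, rfl, hBD⟩ := exists_append_of_not_subset hnot
  simp only [List.getLast_append_of_ne_nil _ hD, List.head_append_of_ne_nil hB] at h₁ h₂ h
  exact exists_improvement_of_swap hHG hL hg hA hB hD (by simpa using hrot) h₁ hBD h₂ h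

theorem exists_improvement [Fintype V] {G : SimpleGraph V} {H : Set (Sym2 V)}
    (hHG : H ⊆ G.edgeSet)
    (hdeg : ∀ x a b c, s(x, a) ∈ H → s(x, b) ∈ H → s(x, c) ∈ H → a = b ∨ a = c ∨ b = c)
    (hconn : ∀ S : Set V, (∀ a b, a ∈ S → s(a, b) ∈ H → b ∈ S) → S.Nonempty → S = Set.univ)
    {L : List V} (hL : IsCircleOrdering L) (hg : numGaps G L = 0)
    {x y : V} (hxy : s(x, y) ∈ H) (hxyL : s(x, y) ∉ adjPairs L) :
    ∃ M : List V, IsCircleOrdering M ∧ KGStep L M ∧ distTo H M + 1 ≤ distTo H L ∧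
      numGaps G M ≤ 2 ∧ delta G H M ≤ delta G H L - 1 / 3 := by
  have hxy' : x ≠ y := fun h => G.loopless.irrefl y (by simpa [h] using hHG hxy)
  obtain ⟨P, Q, hPQ⟩ := List.append_of_mem (hL.2 y)
  have hrot₀ : L ~r y :: (Q ++ P) := by
    rw [hPQ]
    simpa using isRotated_append_comm P (y :: Q)
  obtain ⟨S, T, hST⟩ : ∃ S T, Q ++ P = S ++ x :: T := by
    refine List.append_of_mem ?_
    have := hrot₀.perm.mem_iff.1 (hL.2 x)
    simpa [hxy'] using this
  rw [hST] at hrot₀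
  have hrot₁ : L ~r (y :: S) ++ (x :: T) := hrot₀
  have hrot₂ : L ~r (x :: T) ++ (y :: S) := hrot₁.trans (isRotated_append_comm _ _)
  have hrot₃ : L ~r (S ++ [x]) ++ (T ++ [y]) := by
    refine hrot₁.trans ?_
    simpa using isRotated_append_comm [y] (S ++ x :: T)
  have hrot₄ : L ~r T ++ (y :: (S ++ [x])) := by
    refine hrot₁.trans ?_
    simpa using isRotated_append_comm (y :: (S ++ [x])) T
  have hrot₅ : L ~r S ++ (x :: (T ++ [y])) := by
    refine hrot₁.trans ?_
    simpa using isRotated_append_comm [y] (S ++ x :: T)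
  have hmem {M : List V} (hM : L ~r M) : s(x, y) ∉ adjPairs M := fun h =>
    hxyL ((adjPairs_perm_of_isRotated hM).mem_iff.2 h)
  have hS : S ≠ [] := by
    rintro rfl
    apply hmem hrot₁
    rw [adjPairs_append (by simp) (by simp)]
    simp
  have hT : T ≠ [] := by
    rintro rfl
    apply hmem hrot₂
    rw [adjPairs_append (by simp) (by simp)]
    simp
  have hnd := hrot₁.perm.nodup_iff.1 hL.1
  have hxS : x ∉ S := fun h => (List.nodup_append.1 hnd).2.2 x (by simp [h]) x (by simp) rfl
  have hxT : x ∉ T := fun h => by simp_all [List.nodup_append]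
  have hyS : y ∉ S := fun h => by simp_all [List.nodup_append]
  have hyT : y ∉ T := fun h => by simp_all [List.nodup_append]
  have hdisj : ∀ a ∈ S, ∀ b ∈ T, a ≠ b := by
    intro a ha b hb
    exact (List.nodup_append.1 hnd).2.2 a (by simp [ha]) b (by simp [hb])
  have hx : s(S.getLast hS, x) ∉ H ∨ s(x, T.head hT) ∉ H := by
    by_contra! hc
    rw [Sym2.eq_swap] at hc
    rcases hdeg x _ _ _ hxy hc.1 hc.2 with h | h | h
    · exact hyS (h ▸ List.getLast_mem hS)
    · exact hyT (h ▸ List.head_mem hT)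
    · exact hdisj _ (List.getLast_mem hS) _ (List.head_mem hT) h
  have hy : s(T.getLast hT, y) ∉ H ∨ s(y, S.head hS) ∉ H := by
    by_contra! hc
    rw [Sym2.eq_swap] at hxy hc
    rcases hdeg y _ _ _ hxy hc.1 hc.2 with h | h | h
    · exact hxT (h ▸ List.getLast_mem hT)
    · exact hxS (h ▸ List.head_mem hS)
    · exact hdisj _ (List.head_mem hS) _ (List.getLast_mem hT) h.symm
  have hyx : s(y, x) ∈ H := Sym2.eq_swap ▸ hxy
  have hSpos := List.length_pos_iff.2 hS
  have hTpos := List.length_pos_iff.2 hT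
  rcases hx with hx | hx <;> rcases hy with hy | hy
  · refine exists_improvement_of_reverse hHG hL hg (by simp) (by simp) hrot₁ ?_ ?_ (Or.inl ?_)
    · simpa [List.getLast_cons hS] using hx
    · simpa [List.getLast_cons hT] using hy
    · simpa using hyx
  · refine exists_improvement_of_chord hHG hdeg hconn hL hg hS (by simp) ?_ hrot₅ ?_ ?_ ?_
    · simp; omega
    · simpa using hx
    · simpa using hy
    · simpa using hyx
  · refine exists_improvement_of_chord hHG hdeg hconn hL hg hT (by simp) ?_ hrot₄ ?_ ?_ ?_
    · simp; omega
    · simpa using hy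
    · simpa using hx
    · simpa using hxy
  · refine exists_improvement_of_reverse hHG hL hg (by simp) (by simp) hrot₃ ?_ ?_ (Or.inr ?_)
    · simpa [List.head_append_of_ne_nil hT] using hx
    · simpa [List.head_append_of_ne_nil hS] using hy
    · simpa using hyx

theorem SimpleGraph.Walk.mem_iff_of_mem_support {G : SimpleGraph V} {S : Set V} {u w : V}
    (q : G.Walk u w) (hS : ∀ a b, a ∈ S → s(a, b) ∈ q.edges → b ∈ S) {z : V}
    (hz : z ∈ q.support) : u ∈ S ↔ z ∈ S := by
  induction q with
  | nil => simp_all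
  | @cons a b c hab q ih =>
    have hiff : a ∈ S ↔ b ∈ S :=
      ⟨fun h => hS a b h (by simp), fun h => hS b a h (by simp [Sym2.eq_swap])⟩
    rcases List.mem_cons.1 hz with rfl | hz
    · rfl
    · exact hiff.trans (ih (fun c d hc hcd => hS c d hc (by simp [hcd])) hz)

theorem SimpleGraph.Walk.IsCycle.eq_or_eq_or_eq_of_mem_edges {G : SimpleGraph V} {v : V}
    {p : G.Walk v v} (hp : p.IsCycle) (x a b c : V) (ha : s(x, a) ∈ p.edges)
    (hb : s(x, b) ∈ p.edges) (hc : s(x, c) ∈ p.edges) : a = b ∨ a = c ∨ b = c := by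
  have hcard := hp.ncard_neighborSet_toSubgraph_eq_two (p.fst_mem_support_of_mem_edges ha)
  by_contra! h
  have hfin : (p.toSubgraph.neighborSet x).Finite :=
    Set.finite_of_ncard_ne_zero (by omega)
  have hsub : ({a, b, c} : Set V) ⊆ p.toSubgraph.neighborSet x := by
    rintro z (rfl | rfl | rfl) <;>
      simpa [SimpleGraph.Subgraph.mem_neighborSet, ← SimpleGraph.Subgraph.mem_edgeSet]
  have := Set.ncard_le_ncard hsub hfin
  rw [Set.ncard_eq_three.2 ⟨a, b, c, h.1, h.2.1, h.2.2, rfl⟩] at this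
  omega

/-- from a gap-free circle ordering whose adjacent pairs do not
form the edge set of the Hamiltonian cycle `H`, at most one κ-move and at most
one γ-move produce an ordering whose distance to `H` decreases by at least 1
and which has at most 2 gaps; consequently `Δ` decreases by at least `1/3`. -/
theorem stmt5 [Fintype V] [DecidableEq V] (G : SimpleGraph V)
    (hn : 3 ≤ Fintype.card V)
    {v : V} (p : G.Walk v v) (hp : p.IsHamiltonianCycle)
    (L : List V) (hL : IsCircleOrdering L) (hg : numGaps G L = 0)
    (hne : {e | e ∈ adjPairs L} ≠ {e | e ∈ p.edges}) :
    ∃ M : List V, IsCircleOrdering M ∧ KGStep L M ∧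
      distTo {e | e ∈ p.edges} M + 1 ≤ distTo {e | e ∈ p.edges} L ∧
      numGaps G M ≤ 2 ∧
      delta G {e | e ∈ p.edges} M ≤ delta G {e | e ∈ p.edges} L - 1/3 := by
  obtain ⟨e, heH, heL⟩ : ∃ e ∈ p.edges, e ∉ adjPairs L := by
    by_contra! hsub
    have hlen : (adjPairs L).length ≤ p.edges.length := by
      rw [length_adjPairs, SimpleGraph.Walk.length_edges, hp.length_eq]
      exact hL.1.length_le_card
    have hperm := (hp.isCycle.edges_nodup.subperm hsub).perm_of_length_le hlen
    exact hne (Set.ext fun e => hperm.symm.mem_iff)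
  induction e with | _ x y
  refine exists_improvement (fun e he => p.edges_subset_edgeSet he)
    hp.isCycle.eq_or_eq_or_eq_of_mem_edges ?_ hL hg heH heL
  rintro S hS ⟨z, hz⟩
  have hiff (w : V) : v ∈ S ↔ w ∈ S := p.mem_iff_of_mem_support hS (hp.mem_support w)
  exact Set.eq_univ_of_forall fun w => (hiff w).1 ((hiff z).2 hz)
end

section
/- (SLH closing 3-opt.) Let G be a simple graph on n ≥ 3 vertices and let L be a circle ordering of G written cyclically as L = X ++ Y ++ Z, where X = (x, …, c), Y = (a, …, b) and Z = (d, …, y) are nonempty segments. Suppose {y, x} is a gap of L and {x, a}, {c, d} and {b, y} are edges of G. Then the circle ordering L′ = Z ++ Y.reverse ++ X = (d, …, y, b, …, a, x, …, c) satisfies g(L′) ≤ g(L) − 1. -/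
variable {V : Type*}

open Classical in
/-- The number of consecutive pairs of the (non-cyclic) list that are not edges of `G`. -/
noncomputable def pathGaps (G : SimpleGraph V) : List V → ℕ
  | [] => 0
  | [_] => 0
  | u :: w :: l => (if G.Adj u w then 0 else 1) + pathGaps G (w :: l)

theorem pathGaps_append (G : SimpleGraph V) {A B : List V} {u w : V}
    (hu : A.getLast? = some u) (hw : B.head? = some w) :
    pathGaps G (A ++ B) = pathGaps G A + pathGaps G [u, w] + pathGaps G B := by
  obtain ⟨t, rfl⟩ : ∃ t, B = w :: t := List.head?_eq_some_iff.mp hw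
  induction A with
  | nil => simp at hu
  | cons p A ih =>
    cases A with
    | nil =>
      obtain rfl : p = u := by simpa using hu
      simp [pathGaps]
    | cons q A =>
      have h := ih (by simpa using hu)
      simp only [List.cons_append, pathGaps] at h ⊢
      omega

theorem pathGaps_reverse (G : SimpleGraph V) (A : List V) :
    pathGaps G A.reverse = pathGaps G A := by
  induction A with
  | nil => rfl
  | cons p A ih =>
    cases A with
    | nil => rfl
    | cons q A =>
      rw [List.reverse_cons, pathGaps_append G (u := q) (w := p) (by simp) rfl, ih]
      by_cases H : G.Adj p q <;> simp [pathGaps, H, G.adj_comm q p, add_comm]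

theorem countP_zip_eq_pathGaps (G : SimpleGraph V) (h z : V) (t : List V) :
    (((h :: t).zip (t ++ [z])).map (fun p => s(p.1, p.2))).countP
      (fun e => @decide (e ∉ G.edgeSet) (Classical.propDecidable _)) =
      pathGaps G (h :: (t ++ [z])) := by
  induction t generalizing h with
  | nil => by_cases H : G.Adj h z <;> simp [pathGaps, H]
  | cons q t ih =>
    have := ih q
    rw [List.cons_append, List.zip_cons_cons, List.map_cons, List.countP_cons, this, pathGaps]
    by_cases H : G.Adj h q <;> simp [H, add_comm]

theorem numGaps_eq_pathGaps_add (G : SimpleGraph V) {L : List V} {x y : V}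
    (hx : L.head? = some x) (hy : L.getLast? = some y) :
    numGaps G L = pathGaps G L + pathGaps G [y, x] := by
  obtain ⟨t, rfl⟩ : ∃ t, L = x :: t := List.head?_eq_some_iff.mp hx
  have h := pathGaps_append G (B := [x]) hy rfl
  rw [numGaps, adjPairs, List.rotate_cons_succ, List.rotate_zero, countP_zip_eq_pathGaps]
  simpa [pathGaps] using h

/-- SLH closing 3-opt: if `{y,x}` is a gap of
`L = (x,…,c) ++ (a,…,b) ++ (d,…,y)` and `{x,a}`, `{c,d}`, `{b,y}` are edges of
`G`, then the rearranged ordering `(d,…,y,b,…,a,x,…,c)` has at least one gap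
fewer. -/
theorem stmt9 [Fintype V] (G : SimpleGraph V) (hn : 3 ≤ Fintype.card V)
    (X Y Z : List V) (x c a b d y : V)
    (hX : X ≠ []) (hY : Y ≠ []) (hZ : Z ≠ [])
    (hx : X.head? = some x) (hc : X.getLast? = some c)
    (ha : Y.head? = some a) (hb : Y.getLast? = some b)
    (hd : Z.head? = some d) (hy : Z.getLast? = some y)
    (hL : IsCircleOrdering (X ++ Y ++ Z))
    (hgap : s(y, x) ∉ G.edgeSet)
    (hedge1 : s(x, a) ∈ G.edgeSet) (hedge2 : s(c, d) ∈ G.edgeSet)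
    (hedge3 : s(b, y) ∈ G.edgeSet) :
    numGaps G (Z ++ Y.reverse ++ X) + 1 ≤ numGaps G (X ++ Y ++ Z) := by
  have hYh : Y.reverse.head? = some b := by rw [List.head?_reverse, hb]
  have hYl : Y.reverse.getLast? = some a := by rw [List.getLast?_reverse, ha]
  rw [numGaps_eq_pathGaps_add G (x := d) (y := c) (by simp [hd]) (by simp [hc]),
    numGaps_eq_pathGaps_add G (x := x) (y := y) (by simp [hx]) (by simp [hy]),
    pathGaps_append G (u := a) (w := x) (by simp [ha]) hx,
    pathGaps_append G hy hYh, pathGaps_reverse,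
    pathGaps_append G (u := b) (w := d) (by simp [hb]) hd, pathGaps_append G hc ha]
  rw [SimpleGraph.mem_edgeSet] at hgap hedge1 hedge2 hedge3
  simp only [pathGaps, hgap, hedge1.symm, hedge2, hedge3.symm, if_true, if_false]
  omega
end

section
/- For any circle ordering of an n-element vertex set (n ≥ 3) written cyclically as X ++ Y ++ Z with X, Y, Z nonempty segments, the circle ordering Z ++ Y.reverse ++ X can be obtained from X ++ Y ++ Z by a composition of two γ-moves, each applied up to equivalence; that is, the 3-opt/3-flo rearrangement (x,…,c,a,…,b,d,…,y) ↦ (d,…,y,b,…,a,x,…,c) is a composition of two γ-moves. -/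
variable {V : Type*}

/-- the 3-opt/3-flo rearrangement
`X ++ Y ++ Z ↦ Z ++ Y.reverse ++ X` is a composition of two γ-moves, each
applied up to equivalence. -/
theorem stmt16 [Fintype V] (hn : 3 ≤ Fintype.card V)
    (X Y Z : List V) (hX : X ≠ []) (hY : Y ≠ []) (hZ : Z ≠ [])
    (hL : IsCircleOrdering (X ++ Y ++ Z)) :
    ∃ K M : List V, GammaStep (X ++ Y ++ Z) K ∧ GammaStep K M ∧
      OrderEquiv M (Z ++ Y.reverse ++ X) := by
  refine ⟨Z.reverse ++ Y.reverse ++ X, Z ++ Y.reverse ++ X,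
    ⟨Y ++ Z ++ X, Or.inl ⟨X.length, ?_⟩, Y ++ Z, X, by simp [hY], hX, rfl, by simp⟩,
    ⟨Z.reverse ++ Y.reverse ++ X, Or.inl ⟨0, by simp⟩,
      Z.reverse, Y.reverse ++ X, by simpa using hZ, by simp [hX], by simp, by simp⟩,
    Or.inl ⟨0, by simp⟩⟩
  rw [List.append_assoc X, List.rotate_append_length_eq]
end

section
/- For any circle ordering of an n-element vertex set (n ≥ 3) written cyclically as A ++ B ++ C ++ D with A, B, C, D nonempty segments, the circle ordering C.reverse ++ D.reverse ++ A.reverse ++ B.reverse can be obtained from A ++ B ++ C ++ D by a composition of one κ-move followed by two γ-moves, each applied up to equivalence; that is, the 4-flo type 1 rearrangement is representable as γ ∘ γ ∘ κ. -/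
variable {V : Type*}

/-- the 4-flo type 1 rearrangement
`A ++ B ++ C ++ D ↦ C.reverse ++ D.reverse ++ A.reverse ++ B.reverse` is a
composition of one κ-move followed by two γ-moves, each applied up to
equivalence. -/
theorem stmt17 [Fintype V] (hn : 3 ≤ Fintype.card V)
    (A B C D : List V) (hA : A ≠ []) (hB : B ≠ []) (hC : C ≠ []) (hD : D ≠ [])
    (hL : IsCircleOrdering (A ++ B ++ C ++ D)) :
    ∃ K₁ K₂ K₃ : List V, KappaStep (A ++ B ++ C ++ D) K₁ ∧
      GammaStep K₁ K₂ ∧ GammaStep K₂ K₃ ∧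
      OrderEquiv K₃ (C.reverse ++ D.reverse ++ A.reverse ++ B.reverse) := by
  have self_equiv (L : List V) : OrderEquiv L L := Or.inl ⟨0, by simp⟩
  refine ⟨A.reverse ++ B.reverse ++ (C ++ D), (A.reverse ++ B.reverse ++ C).reverse ++ D,
    C ++ (B ++ A ++ D), ⟨_, self_equiv _, A, B, [], C ++ D, hA, hB, by simp [hC], by simp, by simp⟩,
    ⟨_, self_equiv _, A.reverse ++ B.reverse ++ C, D, by simp [hC], hD, by simp, rfl⟩,
    ⟨_, self_equiv _, C.reverse, B ++ A ++ D, by simp [hC], by simp [hD], by simp, by simp⟩,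
    Or.inr ⟨(D.reverse ++ A.reverse ++ B.reverse).length, ?_⟩⟩
  have h := List.rotate_append_length_eq (D.reverse ++ A.reverse ++ B.reverse) C.reverse
  simpa only [List.reverse_append, List.append_assoc] using h.symm
end

section
/- For any circle ordering of an n-element vertex set (n ≥ 3) written cyclically as A ++ B ++ C ++ D ++ (d) ++ E, with A, B, C, D, E nonempty segments and (d) a single vertex, the circle ordering D ++ (d) ++ B ++ A ++ C ++ E can be obtained from A ++ B ++ C ++ D ++ (d) ++ E by a composition of two κ-moves, each applied up to equivalence; that is, the 5-flo rearrangement is representable as κ ∘ κ. -/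
variable {V : Type*}

/-- the 5-flo rearrangement
`A ++ B ++ C ++ D ++ (d) ++ E ↦ D ++ (d) ++ B ++ A ++ C ++ E` is a composition
of two κ-moves, each applied up to equivalence. -/
theorem stmt18 [Fintype V] (hn : 3 ≤ Fintype.card V)
    (A B C D E : List V) (d : V)
    (hA : A ≠ []) (hB : B ≠ []) (hC : C ≠ []) (hD : D ≠ []) (hE : E ≠ [])
    (hL : IsCircleOrdering (A ++ B ++ C ++ D ++ [d] ++ E)) :
    ∃ K₁ K₂ : List V, KappaStep (A ++ B ++ C ++ D ++ [d] ++ E) K₁ ∧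
      KappaStep K₁ K₂ ∧
      OrderEquiv K₂ (D ++ [d] ++ B ++ A ++ C ++ E) := by
  refine ⟨A.reverse ++ B.reverse ++ E ++ (C ++ D ++ [d]).reverse,
    D ++ [d] ++ B ++ A ++ C ++ E,
    ⟨_, Or.inl ⟨0, (List.rotate_zero _).symm⟩, A, B, C ++ D ++ [d], E, hA, hB, hE, by simp, rfl⟩,
    ⟨_, Or.inl ⟨_, (List.rotate_append_length_eq _ _).symm⟩,
      [d] ++ D.reverse, C.reverse ++ A.reverse ++ B.reverse, [], E,
      by simp, by simp [hC], hE, by simp, by simp⟩,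
    Or.inl ⟨0, (List.rotate_zero _).symm⟩⟩
end
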